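/- Let H be an invertible Hermitian n×n complex matrix and let v, w ∈ ℂⁿ satisfy q_H(v) = q_H(w) ≠ 0. Then there exists a matrix A ∈ M_n(ℂ) with Aᴴ H A = H and A *ᵥ v = w. (The unitary group U(H) acts transitively on each nonzero level set of q_H.) -/

import Mathlib

open Matrix

/-- For a Hermitian matrix `H`, `qH H v` is the (real) value of the Hermitian form
`star v ⬝ᵥ (H *ᵥ v)`, identified with its real part. -/
noncomputable def qH {n : ℕ} (H : Matrix (Fin n) (Fin n) ℂ) (v : Fin n → ℂ) : ℝ :=
  (star v ⬝ᵥ (H *ᵥ v)).re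

/-- The value of a Hermitian form on a diagonal pair is real, hence equal to `qH`. -/
theorem Matrix.IsHermitian.dotProduct_mulVec_self_eq_qH {n : ℕ}
    {H : Matrix (Fin n) (Fin n) ℂ} (hH : H.IsHermitian) (v : Fin n → ℂ) :
    star v ⬝ᵥ (H *ᵥ v) = (qH H v : ℂ) :=
  Complex.ext rfl (by simpa using hH.im_star_dotProduct_mulVec_self v)

/-- Conjugate symmetry of a Hermitian form. -/
theorem Matrix.IsHermitian.star_dotProduct_mulVec {n : ℕ}
    {H : Matrix (Fin n) (Fin n) ℂ} (hH : H.IsHermitian) (v w : Fin n → ℂ) :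
    star (star v ⬝ᵥ (H *ᵥ w)) = star w ⬝ᵥ (H *ᵥ v) := by
  rw [← star_dotProduct_star, star_star, star_mulVec, hH.eq, ← dotProduct_mulVec]

/-- The quasi-reflection `x ↦ x - s⁻¹ B(u, x) u` of the sesquilinear form `B` with matrix `H`. -/
noncomputable def quasiReflection {n : ℕ} (H : Matrix (Fin n) (Fin n) ℂ) (u : Fin n → ℂ)
    (s : ℂ) : Matrix (Fin n) (Fin n) ℂ :=
  1 - s⁻¹ • vecMulVec u (star u ᵥ* H)

theorem quasiReflection_mulVec {n : ℕ} (H : Matrix (Fin n) (Fin n) ℂ) (u x : Fin n → ℂ) (s : ℂ) :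
    quasiReflection H u s *ᵥ x = x - (s⁻¹ * (star u ⬝ᵥ (H *ᵥ x))) • u := by
  rw [quasiReflection, sub_mulVec, one_mulVec, smul_mulVec, vecMulVec_mulVec, dotProduct_mulVec,
    op_smul_eq_smul, smul_smul]

/-- A quasi-reflection preserves the form when `B(u, u) = s + star s`. -/
theorem quasiReflection_unitary {n : ℕ} {H : Matrix (Fin n) (Fin n) ℂ} (hH : H.IsHermitian)
    (u : Fin n → ℂ) {s : ℂ} (hs : s ≠ 0) (hu : star u ⬝ᵥ (H *ᵥ u) = s + star s) :
    (quasiReflection H u s)ᴴ * H * quasiReflection H u s = H := by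
  have hs' : star s ≠ 0 := star_ne_zero.mpr hs
  have hadj : (quasiReflection H u s)ᴴ = 1 - (star s)⁻¹ • vecMulVec (H *ᵥ u) (star u) := by
    rw [quasiReflection, conjTranspose_sub, conjTranspose_one, conjTranspose_smul, star_inv₀,
      conjTranspose_vecMulVec, star_vecMul, star_star, hH.eq]
  have hcoef : s⁻¹ * ((star s)⁻¹ * (s + star s)) = (star s)⁻¹ + s⁻¹ := by
    field_simp
  rw [hadj, quasiReflection]
  simp only [sub_mul, mul_sub, one_mul, mul_one, smul_mul_assoc, mul_smul_comm,
    vecMulVec_mul, mul_vecMulVec, vecMulVec_mulVec, ← dotProduct_mulVec,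
    op_smul_eq_smul, smul_vecMulVec, hu, smul_smul]
  rw [smul_sub, smul_smul, hcoef]
  module

/-- If `q_H(v) = q_H(w)` and `B(v - w, v) ≠ 0`, a quasi-reflection along `v - w` sends `v` to
`w`. -/
theorem exists_unitary_mulVec_eq {n : ℕ} {H : Matrix (Fin n) (Fin n) ℂ} (hH : H.IsHermitian)
    {v w : Fin n → ℂ} (hvw : qH H v = qH H w) (hs : star (v - w) ⬝ᵥ (H *ᵥ v) ≠ 0) :
    ∃ A : Matrix (Fin n) (Fin n) ℂ, Aᴴ * H * A = H ∧ A *ᵥ v = w := by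
  refine ⟨quasiReflection H (v - w) (star (v - w) ⬝ᵥ (H *ᵥ v)),
    quasiReflection_unitary hH _ hs ?_, ?_⟩
  · rw [hH.star_dotProduct_mulVec]
    simp only [star_sub, mulVec_sub, sub_dotProduct, dotProduct_sub,
      hH.dotProduct_mulVec_self_eq_qH, hvw]
    ring
  · rw [quasiReflection_mulVec, inv_mul_cancel₀ hs, one_smul, sub_sub_cancel]

/-- Witt-type transitivity: the unitary group `U(H)` of an invertible Hermitian form `H`
acts transitively on each nonzero level set of `q_H`. -/
theorem unitary_transitive_on_nonzero_level_sets (n : ℕ)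
    (H : Matrix (Fin n) (Fin n) ℂ) (hH : H.IsHermitian) (hdet : H.det ≠ 0)
    (v w : Fin n → ℂ) (hvw : qH H v = qH H w) (hne : qH H v ≠ 0) :
    ∃ A : Matrix (Fin n) (Fin n) ℂ, Aᴴ * H * A = H ∧ A *ᵥ v = w := by
  by_cases hs : star (v - w) ⬝ᵥ (H *ᵥ v) = 0
  · have hneg : qH H v = qH H (-w) := by
      rw [hvw]
      simp [qH, mulVec_neg]
    have hs' : star (v - -w) ⬝ᵥ (H *ᵥ v) ≠ 0 := by
      intro h
      apply hne
      rw [star_sub, sub_dotProduct, hH.dotProduct_mulVec_self_eq_qH] at hs h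
      rw [star_neg, neg_dotProduct] at h
      have h2 : (2 : ℂ) * (qH H v : ℂ) = 0 := by linear_combination hs + h
      simpa using h2
    obtain ⟨A, hA, hAv⟩ := exists_unitary_mulVec_eq hH hneg hs'
    exact ⟨-A, by simpa using hA, by rw [neg_mulVec, hAv, neg_neg]⟩
  · exact exists_unitary_mulVec_eq hH hvw hs
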